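/- arXiv:1604.02772 — 5 statements merged into one kernel-verified Lean document; each statement's English description precedes it below -/
import Mathlib

section
/- Let u, u₁, u₂, u₁₂, p, q be real numbers with p ≠ 0 and q ≠ 0, and for λ > 0 define Δ₊ = sqrt(1+(p/2)²λ²), Δ₋ = sqrt(1+(q/2)²λ^{-2}), U(λ) = Δ₊^{-1}·[[e^{-(i/2)(u₁-u)}, (i/2)pλ],[(i/2)pλ, e^{(i/2)(u₁-u)}]], V(λ) = Δ₋^{-1}·[[1, -(i/2)q e^{(i/2)(u₂+u)}λ^{-1}],[-(i/2)q e^{-(i/2)(u₂+u)}λ^{-1}, 1]], U₂(λ) = Δ₊^{-1}·[[e^{-(i/2)(u₁₂-u₂)}, (i/2)pλ],[(i/2)pλ, e^{(i/2)(u₁₂-u₂)}]], and V₁(λ) = Δ₋^{-1}·[[1, -(i/2)q e^{(i/2)(u₁₂+u₁)}λ^{-1}],[-(i/2)q e^{-(i/2)(u₁₂+u₁)}λ^{-1}, 1]]. Then the compatibility condition V(λ)·U₂(λ) = U(λ)·V₁(λ) holds for all λ > 0 if and only if the discrete sine-Gordon (Hirota) equation sin((u₁₂-u₁-u₂+u)/4)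 = (pq/4)·sin((u₁₂+u₁+u₂+u)/4) holds. -/
open Matrix

/-- The compatibility condition `V U₂ = U V₁` of the discrete Lax pair holds for all
`λ > 0` if and only if the discrete sine-Gordon (Hirota) equation holds. -/
theorem discrete_zero_curvature_iff_Hirota
    (u u₁ u₂ u₁₂ p q : ℝ) (hp : p ≠ 0) (hq : q ≠ 0)
    (U U₂ V V₁ : ℝ → Matrix (Fin 2) (Fin 2) ℂ)
    (hU : ∀ lam : ℝ, U lam =
      (((Real.sqrt (1 + (p / 2) ^ 2 * lam ^ 2))⁻¹ : ℝ) : ℂ) •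
        !![Complex.exp (-(Complex.I / 2) * (u₁ - u)), Complex.I / 2 * p * lam;
           Complex.I / 2 * p * lam, Complex.exp ((Complex.I / 2) * (u₁ - u))])
    (hU₂ : ∀ lam : ℝ, U₂ lam =
      (((Real.sqrt (1 + (p / 2) ^ 2 * lam ^ 2))⁻¹ : ℝ) : ℂ) •
        !![Complex.exp (-(Complex.I / 2) * (u₁₂ - u₂)), Complex.I / 2 * p * lam;
           Complex.I / 2 * p * lam, Complex.exp ((Complex.I / 2) * (u₁₂ - u₂))])
    (hV : ∀ lam : ℝ, V lam =
      (((Real.sqrt (1 + (q / 2) ^ 2 * (lam ^ 2)⁻¹))⁻¹ : ℝ) : ℂ) •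
        !![1, -(Complex.I / 2) * q * Complex.exp ((Complex.I / 2) * (u₂ + u)) * (lam : ℂ)⁻¹;
           -(Complex.I / 2) * q * Complex.exp (-(Complex.I / 2) * (u₂ + u)) * (lam : ℂ)⁻¹, 1])
    (hV₁ : ∀ lam : ℝ, V₁ lam =
      (((Real.sqrt (1 + (q / 2) ^ 2 * (lam ^ 2)⁻¹))⁻¹ : ℝ) : ℂ) •
        !![1, -(Complex.I / 2) * q * Complex.exp ((Complex.I / 2) * (u₁₂ + u₁)) * (lam : ℂ)⁻¹;
           -(Complex.I / 2) * q * Complex.exp (-(Complex.I / 2) * (u₁₂ + u₁)) * (lam : ℂ)⁻¹, 1]) :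
    (∀ lam : ℝ, 0 < lam → V lam * U₂ lam = U lam * V₁ lam) ↔
      Real.sin ((u₁₂ - u₁ - u₂ + u) / 4) =
        p * q / 4 * Real.sin ((u₁₂ + u₁ + u₂ + u) / 4) := by
  have hne : ∀ x : ℝ, Complex.exp (Complex.I * x / 4) ≠ 0 := fun x => Complex.exp_ne_zero _
  have e1 : ∀ x y : ℝ, Complex.exp ((Complex.I / 2) * (x - y)) =
      Complex.exp (Complex.I * x / 4) ^ 2 / Complex.exp (Complex.I * y / 4) ^ 2 := by
    intro x y
    rw [← Complex.exp_nat_mul, ← Complex.exp_nat_mul, ← Complex.exp_sub]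
    congr 1; push_cast; ring
  have e2 : ∀ x y : ℝ, Complex.exp (-(Complex.I / 2) * (x - y)) =
      Complex.exp (Complex.I * y / 4) ^ 2 / Complex.exp (Complex.I * x / 4) ^ 2 := by
    intro x y
    rw [← e1]; congr 1; ring
  have e3 : ∀ x y : ℝ, Complex.exp ((Complex.I / 2) * (x + y)) =
      Complex.exp (Complex.I * x / 4) ^ 2 * Complex.exp (Complex.I * y / 4) ^ 2 := by
    intro x y
    rw [← Complex.exp_nat_mul, ← Complex.exp_nat_mul, ← Complex.exp_add]
    congr 1; push_cast; ring
  have e4 : ∀ x y : ℝ, Complex.exp (-(Complex.I / 2) * (x + y)) =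
      1 / (Complex.exp (Complex.I * x / 4) ^ 2 * Complex.exp (Complex.I * y / 4) ^ 2) := by
    intro x y
    rw [← e3, one_div, ← Complex.exp_neg]; congr 1; ring
  have s1 : Complex.sin (((u₁₂ : ℂ) - u₁ - u₂ + u) / 4) =
      (Complex.exp (Complex.I * u₁ / 4) * Complex.exp (Complex.I * u₂ / 4) /
        (Complex.exp (Complex.I * u₁₂ / 4) * Complex.exp (Complex.I * u / 4)) -
       Complex.exp (Complex.I * u₁₂ / 4) * Complex.exp (Complex.I * u / 4) /
        (Complex.exp (Complex.I * u₁ / 4) * Complex.exp (Complex.I * u₂ / 4))) *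
        Complex.I / 2 := by
    simp only [← Complex.exp_add, ← Complex.exp_sub, Complex.sin]
    congr 4 <;> ring
  have s2 : Complex.sin (((u₁₂ : ℂ) + u₁ + u₂ + u) / 4) =
      (1 / (Complex.exp (Complex.I * u₁ / 4) * Complex.exp (Complex.I * u₂ / 4) *
        Complex.exp (Complex.I * u₁₂ / 4) * Complex.exp (Complex.I * u / 4)) -
       Complex.exp (Complex.I * u₁ / 4) * Complex.exp (Complex.I * u₂ / 4) *
        Complex.exp (Complex.I * u₁₂ / 4) * Complex.exp (Complex.I * u / 4)) *
        Complex.I / 2 := by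
    simp only [one_div, ← Complex.exp_add, ← Complex.exp_neg, Complex.sin]
    congr 4 <;> ring
  have hS : (Real.sin ((u₁₂ - u₁ - u₂ + u) / 4) =
        p * q / 4 * Real.sin ((u₁₂ + u₁ + u₂ + u) / 4)) ↔
      (Complex.sin (((u₁₂ : ℂ) - u₁ - u₂ + u) / 4) =
        p * q / 4 * Complex.sin (((u₁₂ : ℂ) + u₁ + u₂ + u) / 4)) := by
    rw [← Complex.ofReal_inj]; push_cast; rfl
  rw [hS, s1, s2]
  simp only [hU, hV, hU₂, hV₁, e1, e2, e3, e4]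
  have ha := hne u
  have hb := hne u₁
  have hc := hne u₂
  have hd := hne u₁₂
  clear hU hV hU₂ hV₁ e1 e2 e3 e4 s1 s2 hS hne
  generalize Complex.exp (Complex.I * u / 4) = a at *
  generalize Complex.exp (Complex.I * u₁ / 4) = b at *
  generalize Complex.exp (Complex.I * u₂ / 4) = c at *
  generalize Complex.exp (Complex.I * u₁₂ / 4) = d at *
  have hI : Complex.I ≠ 0 := Complex.I_ne_zero
  have hI2 : Complex.I ^ 2 = -1 := Complex.I_sq
  have key : ((b * c / (d * a) - d * a / (b * c)) * Complex.I / 2 =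
      p * q / 4 * ((1 / (b * c * d * a) - b * c * d * a) * Complex.I / 2)) ↔
      4 * ((b * c) ^ 2 - (d * a) ^ 2) = p * q * (1 - (b * c * d * a) ^ 2) := by
    constructor
    · intro h
      field_simp at h
      linear_combination h
    · intro h
      field_simp
      linear_combination h
  rw [key]
  clear key
  have hs : ∀ lam : ℝ, 0 < lam →
      ((((Real.sqrt (1 + (p / 2) ^ 2 * lam ^ 2))⁻¹ : ℝ) : ℂ) ≠ 0 ∧
      (((Real.sqrt (1 + (q / 2) ^ 2 * (lam ^ 2)⁻¹))⁻¹ : ℝ) : ℂ) ≠ 0) := by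
    intro lam hl
    constructor <;> (apply Complex.ofReal_ne_zero.mpr; positivity)
  constructor
  · intro h
    have h1 := h 1 one_pos
    obtain ⟨k1, k2⟩ := hs 1 one_pos
    generalize (((Real.sqrt (1 + (p / 2) ^ 2 * 1 ^ 2))⁻¹ : ℝ) : ℂ) = x at *
    generalize (((Real.sqrt (1 + (q / 2) ^ 2 * (1 ^ 2)⁻¹))⁻¹ : ℝ) : ℂ) = y at *
    rw [Matrix.smul_mul, Matrix.mul_smul, Matrix.smul_mul, Matrix.mul_smul,
      smul_comm y x] at h1
    have h2 := smul_right_injective _ k2 (smul_right_injective _ k1 h1)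
    have h3 := congrFun (congrFun h2 0) 0
    simp [Matrix.mul_apply, Fin.sum_univ_two] at h3
    field_simp at h3
    simp only [hI2] at h3
    linear_combination h3
  · intro h lam hl
    have hl' : (lam : ℂ) ≠ 0 := Complex.ofReal_ne_zero.mpr hl.ne'
    rw [Matrix.smul_mul, Matrix.mul_smul, Matrix.smul_mul, Matrix.mul_smul, smul_comm]
    congr 2
    ext i j
    fin_cases i <;> fin_cases j <;> simp [Matrix.mul_apply, Fin.sum_univ_two] <;> field_simp <;>
      try simp only [hI2]
    · linear_combination h
    · ring
    · ring
    · linear_combination -h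
end

section
/- Let w, p ∈ ℝ with p ≠ 0, let λ > 0, set Δ₊ = sqrt(1+(p/2)²λ²) and U(λ) = Δ₊^{-1}·[[e^{-(i/2)w}, (i/2)pλ],[(i/2)pλ, e^{(i/2)w}]]. Then λ·U'(λ)·U(λ)^{-1} = (iλp/(2(1+(p/2)²λ²)))·[[0, e^{-(i/2)w}],[e^{(i/2)w}, 0]], where ' denotes differentiation in λ; in particular this matrix is trace-free, skew-hermitian, and -2·trace((λ·U'(λ)·U(λ)^{-1})²) = (λp)²/(1+(p/2)²λ²)². -/
open Matrix

attribute [local instance] Matrix.normedAddCommGroup Matrix.normedSpace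

/-- For the `n`-direction transition matrix `U(λ)` of the discrete Lax pair,
`λ U'(λ) U(λ)⁻¹` is the explicit off-diagonal matrix stated, and it is trace-free,
skew-hermitian, with `-2 trace((λU'U⁻¹)²) = (λp)²/(1+(p/2)²λ²)²`. -/
theorem sym_edge_U (w p : ℝ) (hp : p ≠ 0) (lam : ℝ) (hlam : 0 < lam)
    (U : ℝ → Matrix (Fin 2) (Fin 2) ℂ)
    (hU : ∀ t : ℝ, U t =
      (((Real.sqrt (1 + (p / 2) ^ 2 * t ^ 2))⁻¹ : ℝ) : ℂ) •
        !![Complex.exp (-(Complex.I / 2) * w), Complex.I / 2 * p * t;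
           Complex.I / 2 * p * t, Complex.exp ((Complex.I / 2) * w)])
    (X : Matrix (Fin 2) (Fin 2) ℂ)
    (hX : X = (lam : ℂ) • (deriv U lam * (U lam)⁻¹)) :
    X = (Complex.I * lam * p / (2 * (1 + (p / 2) ^ 2 * lam ^ 2))) •
        !![0, Complex.exp (-(Complex.I / 2) * w);
           Complex.exp ((Complex.I / 2) * w), 0] ∧
    X.trace = 0 ∧
    Xᴴ = -X ∧
    -2 * (X * X).trace = (((lam * p) ^ 2 / (1 + (p / 2) ^ 2 * lam ^ 2) ^ 2 : ℝ) : ℂ) := by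
  have hq : 0 < 1 + (p / 2) ^ 2 * lam ^ 2 := by positivity
  obtain ⟨s, hs⟩ : ∃ s, s = Real.sqrt (1 + (p / 2) ^ 2 * lam ^ 2) := ⟨_, rfl⟩
  have hs0 : 0 < s := by rw [hs]; exact Real.sqrt_pos.2 hq
  have hs2 : s ^ 2 = 1 + (p / 2) ^ 2 * lam ^ 2 := by rw [hs]; exact Real.sq_sqrt hq.le
  have hsC0 : (s : ℂ) ≠ 0 := by exact_mod_cast hs0.ne'
  have hs2C : (1 + ((p : ℂ) / 2) ^ 2 * (lam : ℂ) ^ 2) = (s : ℂ) ^ 2 := by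
    exact_mod_cast hs2.symm
  obtain ⟨a, ha⟩ : ∃ a, a = Complex.exp (-(Complex.I / 2) * w) := ⟨_, rfl⟩
  obtain ⟨b, hb⟩ : ∃ b, b = Complex.exp ((Complex.I / 2) * w) := ⟨_, rfl⟩
  have hab : a * b = 1 := by
    rw [ha, hb, ← Complex.exp_add]; simp
  have hsa : star a = b := by
    rw [ha, hb, Complex.star_def, ← Complex.exp_conj]; simp [Complex.conj_ofNat]; congr 1; ring
  have hsb : star b = a := by rw [← hsa, star_star]
  have hsa' : (starRingEnd ℂ) a = b := hsa
  have hsb' : (starRingEnd ℂ) b = a := hsb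
  simp only [← ha, ← hb] at hU ⊢
  have hr : HasDerivAt (fun t : ℝ => (Real.sqrt (1 + (p / 2) ^ 2 * t ^ 2))⁻¹)
      (-((p / 2) ^ 2 * lam) / s ^ 3) lam := by
    have h1 : HasDerivAt (fun t : ℝ => 1 + (p / 2) ^ 2 * t ^ 2)
        ((p / 2) ^ 2 * (2 * lam)) lam := by
      have := ((hasDerivAt_pow 2 lam).const_mul ((p / 2) ^ 2)).const_add 1
      simpa using this
    have h2 := (h1.sqrt hq.ne').inv (by rw [← hs]; exact hs0.ne')
    rw [← hs] at h2
    refine HasDerivAt.congr_deriv h2 ?_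
    field_simp
  have hrC := hr.ofReal_comp
  have hrt := (hr.mul (hasDerivAt_id lam)).ofReal_comp
  have hD := (hrC.smul_const (!![a, 0; 0, b] : Matrix (Fin 2) (Fin 2) ℂ)).add
    (hrt.smul_const (!![0, Complex.I / 2 * p; Complex.I / 2 * p, 0] : Matrix (Fin 2) (Fin 2) ℂ))
  have hUe : U = fun t : ℝ =>
      (((Real.sqrt (1 + (p / 2) ^ 2 * t ^ 2))⁻¹ : ℝ) : ℂ) • !![a, 0; 0, b] +
        (((Real.sqrt (1 + (p / 2) ^ 2 * t ^ 2))⁻¹ * t : ℝ) : ℂ) •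
          !![0, Complex.I / 2 * p; Complex.I / 2 * p, 0] := by
    funext t
    rw [hU]
    ext i j
    fin_cases i <;> fin_cases j <;> simp <;> ring
  have hdU := hD.deriv
  change deriv (fun t : ℝ =>
      (((Real.sqrt (1 + (p / 2) ^ 2 * t ^ 2))⁻¹ : ℝ) : ℂ) • !![a, 0; 0, b] +
        (((Real.sqrt (1 + (p / 2) ^ 2 * t ^ 2))⁻¹ * t : ℝ) : ℂ) •
          !![0, Complex.I / 2 * p; Complex.I / 2 * p, 0]) lam = _ at hdU
  rw [← hUe] at hdU
  have hUl := hU lam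
  rw [← hs] at hUl
  have hI := Complex.I_sq
  have hdet : (U lam).det = 1 := by
    rw [hUl, Matrix.det_smul, Matrix.det_fin_two_of, hab]
    simp
    field_simp
    linear_combination 4 * hs2C - p ^ 2 * lam ^ 2 * hI
  have hmain : deriv U lam = ((Complex.I * p / (2 * (s : ℂ) ^ 2)) • !![0, a; b, 0]) * U lam := by
    rw [hdU, hUl]
    ext i j
    fin_cases i <;> fin_cases j <;> simp [Matrix.mul_apply, ← hs]
    all_goals field_simp
    · linear_combination (-p ^ 2 * lam * a) * hI
    · linear_combination (-4 * p : ℂ) * hs2C - 4 * p * hab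
    · linear_combination (-4 * p : ℂ) * hs2C - 4 * p * hab
    · linear_combination (-p ^ 2 * lam * b) * hI
  have hXe : X = (Complex.I * lam * p / (2 * (1 + (p / 2) ^ 2 * lam ^ 2))) •
        !![0, a; b, 0] := by
    rw [hX, hmain, Matrix.mul_assoc, Matrix.mul_nonsing_inv _ (by rw [hdet]; exact isUnit_one),
      Matrix.mul_one, smul_smul, hs2C]
    congr 1
    ring
  refine ⟨hXe, ?_, ?_, ?_⟩
  · rw [hXe]; simp [Matrix.trace_fin_two]
  · rw [hXe, hs2C]
    ext i j
    fin_cases i <;> fin_cases j <;> simp [hsa', hsb', Complex.conj_ofNat] <;> ring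
  · rw [hXe]
    push_cast
    rw [hs2C]
    simp [Matrix.trace_fin_two, Matrix.mul_apply]
    field_simp
    linear_combination (-2 * lam ^ 2 * p ^ 2 * a * b) * hI + 2 * lam ^ 2 * p ^ 2 * hab
end

section
/- Let v, q ∈ ℝ with q ≠ 0, let λ > 0, set Δ₋ = sqrt(1+(q/2)²λ^{-2}) and V(λ) = Δ₋^{-1}·[[1, -(i/2)q e^{iv}λ^{-1}],[-(i/2)q e^{-iv}λ^{-1}, 1]]. Then λ·V'(λ)·V(λ)^{-1} is trace-free and skew-hermitian and satisfies -2·trace((λ·V'(λ)·V(λ)^{-1})²) = (q/λ)²/(1+(q/2)²λ^{-2})², where ' denotes differentiation in λ. -/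
open Matrix

attribute [local instance] Matrix.normedAddCommGroup Matrix.normedSpace
/-- For the `m`-direction transition matrix `V(λ)` of the discrete Lax pair,
`λ V'(λ) V(λ)⁻¹` is trace-free, skew-hermitian, and satisfies
`-2 trace((λV'V⁻¹)²) = (q/λ)²/(1+(q/2)²λ⁻²)²`. -/
theorem sym_edge_V (v q : ℝ) (hq : q ≠ 0) (lam : ℝ) (hlam : 0 < lam)
    (V : ℝ → Matrix (Fin 2) (Fin 2) ℂ)
    (hV : ∀ t : ℝ, V t =
      (((Real.sqrt (1 + (q / 2) ^ 2 * (t ^ 2)⁻¹))⁻¹ : ℝ) : ℂ) •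
        !![1, -(Complex.I / 2) * q * Complex.exp (Complex.I * v) * (t : ℂ)⁻¹;
           -(Complex.I / 2) * q * Complex.exp (-(Complex.I * v)) * (t : ℂ)⁻¹, 1])
    (X : Matrix (Fin 2) (Fin 2) ℂ)
    (hX : X = (lam : ℂ) • (deriv V lam * (V lam)⁻¹)) :
    X.trace = 0 ∧
    Xᴴ = -X ∧
    -2 * (X * X).trace =
      (((q / lam) ^ 2 / (1 + (q / 2) ^ 2 * (lam ^ 2)⁻¹) ^ 2 : ℝ) : ℂ) := by
  have hD : 0 < 1 + (q / 2) ^ 2 * (lam ^ 2)⁻¹ := by positivity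
  have hl : lam ≠ 0 := hlam.ne'
  obtain ⟨D, hDd⟩ : ∃ D, D = 1 + (q / 2) ^ 2 * (lam ^ 2)⁻¹ := ⟨_, rfl⟩
  obtain ⟨s, hs⟩ : ∃ s, s = (Real.sqrt D)⁻¹ := ⟨_, rfl⟩
  have hD0 : 0 < D := hDd ▸ hD
  have hs0 : s ≠ 0 := by rw [hs]; positivity
  have hsD : s ^ 2 * D = 1 := by
    rw [hs, inv_pow, Real.sq_sqrt hD0.le, inv_mul_cancel₀ hD0.ne']
  obtain ⟨a, ha⟩ : ∃ a, a = -(Complex.I / 2) * q * Complex.exp (Complex.I * v) := ⟨_, rfl⟩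
  obtain ⟨b, hb⟩ : ∃ b, b = -(Complex.I / 2) * q * Complex.exp (-(Complex.I * v)) := ⟨_, rfl⟩
  have hab : a * b = -((q : ℂ) / 2) ^ 2 := by
    have h1 : Complex.exp (Complex.I * v) * Complex.exp (-(Complex.I * v)) = 1 := by
      rw [← Complex.exp_add, add_neg_cancel, Complex.exp_zero]
    rw [ha, hb]
    linear_combination (Complex.I ^ 2 * q ^ 2 / 4) * h1 + (q ^ 2 / 4 : ℂ) * Complex.I_sq
  have hsa : star a = -b := by
    rw [ha, hb]
    simp [← Complex.exp_conj]
    ring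
  have hsb : star b = -a := by
    rw [← neg_eq_iff_eq_neg.mpr hsa, star_neg, star_star]
  have hVf : V = fun t : ℝ => ((Real.sqrt (1 + (q / 2) ^ 2 * (t ^ 2)⁻¹))⁻¹) •
      (1 : Matrix (Fin 2) (Fin 2) ℂ) +
      ((Real.sqrt (1 + (q / 2) ^ 2 * (t ^ 2)⁻¹))⁻¹ * t⁻¹) • !![0, a; b, 0] := by
    funext t
    rw [hV t, ← ha, ← hb]
    ext i j
    fin_cases i <;> fin_cases j <;> simp <;> ring
  have hder1 : HasDerivAt (fun t : ℝ => (Real.sqrt (1 + (q / 2) ^ 2 * (t ^ 2)⁻¹))⁻¹)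
      (s * ((q / 2) ^ 2 * (lam ^ 3)⁻¹ * D⁻¹)) lam := by
    have h1 : HasDerivAt (fun t : ℝ => 1 + (q / 2) ^ 2 * (t ^ 2)⁻¹)
        ((q / 2) ^ 2 * (-(2 * lam) / (lam ^ 2) ^ 2)) lam := by
      have h2 : HasDerivAt (fun t : ℝ => t ^ 2) (2 * lam) lam := by
        simpa using hasDerivAt_pow 2 lam
      exact ((h2.fun_inv (by positivity)).const_mul _).const_add _
    have h3 := (h1.sqrt hD.ne').fun_inv (Real.sqrt_pos.mpr hD).ne'
    refine h3.congr_deriv ?_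
    rw [← hDd, Real.sq_sqrt hD0.le, hs]
    have := (Real.sqrt_pos.mpr hD0).ne'
    field_simp
  have hder2 := hder1.fun_mul (hasDerivAt_inv hl)
  have hderV := (hder1.smul_const (1 : Matrix (Fin 2) (Fin 2) ℂ)).fun_add
    (hder2.smul_const !![0, a; b, 0])
  rw [← hVf] at hderV
  have hd : deriv V lam = (s * ((q / 2) ^ 2 * (lam ^ 3)⁻¹ * D⁻¹)) • (1 : Matrix (Fin 2) (Fin 2) ℂ) +
      (s * ((q / 2) ^ 2 * (lam ^ 3)⁻¹ * D⁻¹) * lam⁻¹ +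
        (Real.sqrt (1 + (q / 2) ^ 2 * (lam ^ 2)⁻¹))⁻¹ * -(lam ^ 2)⁻¹) • !![0, a; b, 0] :=
    hderV.deriv
  have hVl : V lam = s • (1 : Matrix (Fin 2) (Fin 2) ℂ) + (s * lam⁻¹) • !![0, a; b, 0] := by
    rw [hVf, hs, hDd]
  rw [← hDd, ← hs] at hd
  have hlC : (lam : ℂ) ≠ 0 := by exact_mod_cast hl
  have hDC : (D : ℂ) ≠ 0 := by exact_mod_cast hD0.ne'
  have hsC : (s : ℂ) ≠ 0 := by exact_mod_cast hs0
  have hsDC : (s : ℂ) ^ 2 * D = 1 := by exact_mod_cast hsD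
  have hDdC : (D : ℂ) = 1 + (q / 2) ^ 2 * ((lam : ℂ) ^ 2)⁻¹ := by rw [hDd]; push_cast; rfl
  have hDl : (D : ℂ) * lam ^ 2 = lam ^ 2 + (q / 2) ^ 2 := by rw [hDdC]; field_simp
  have hdet : (V lam).det = 1 := by
    rw [hVl, Matrix.det_fin_two]
    simp
    rw [← hsDC, hDdC]
    linear_combination (-(s : ℂ) ^ 2 * ((lam : ℂ)⁻¹) ^ 2) * hab
  have hXe : X = (-((lam : ℂ)⁻¹ * (D : ℂ)⁻¹)) • !![0, a; b, 0] := by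
    have key : (lam : ℂ) • deriv V lam =
        ((-((lam : ℂ)⁻¹ * (D : ℂ)⁻¹)) • !![0, a; b, 0]) * V lam := by
      rw [hd, hVl]
      ext i j
      fin_cases i <;> fin_cases j <;> simp [Matrix.mul_apply, Fin.sum_univ_two]
      · field_simp
        linear_combination 4 * hab
      · field_simp
        linear_combination (-4 * a) * hDl
      · field_simp
        linear_combination (-4 * b) * hDl
      · field_simp
        linear_combination 4 * hab
    rw [hX, ← Matrix.smul_mul, key, Matrix.mul_nonsing_inv_cancel_right]
    rw [hdet]; exact isUnit_one
  subst hXe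
  refine ⟨by simp [Matrix.trace_fin_two], ?_, ?_⟩
  · have h1 : (starRingEnd ℂ) a = -b := hsa
    have h2 : (starRingEnd ℂ) b = -a := hsb
    ext i j
    fin_cases i <;> fin_cases j <;> simp [Matrix.conjTranspose_apply, h1, h2]
  · rw [← hDd]
    simp [Matrix.trace_fin_two, Matrix.mul_apply, Fin.sum_univ_two]
    field_simp
    linear_combination (-4) * hab
end

section
/- Let w, p ∈ ℝ with p ≠ 0, let λ > 0, set Δ₊ = sqrt(1+(p/2)²λ²), U(λ) = Δ₊^{-1}·[[e^{-(i/2)w}, (i/2)pλ],[(i/2)pλ, e^{(i/2)w}]], and let σ₃ = [[1,0],[0,-1]]. Then with X = λ·U'(λ)·U(λ)^{-1} (derivative in λ), both trace(X·σ₃) = 0 and trace(U(λ)^{-1}·X·U(λ)·σ₃) = 0 hold. -/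
open Matrix

attribute [local instance] Matrix.normedAddCommGroup Matrix.normedSpace

/-- With `X = λ U'(λ) U(λ)⁻¹` for the transition matrix `U` of the discrete Lax pair
and `σ₃` the third Pauli matrix, both `trace(X σ₃) = 0` and
`trace(U⁻¹ X U σ₃) = 0` hold (planarity of discrete pseudospherical surfaces). -/
theorem planarity_traces (w p : ℝ) (hp : p ≠ 0) (lam : ℝ) (hlam : 0 < lam)
    (U : ℝ → Matrix (Fin 2) (Fin 2) ℂ)
    (hU : ∀ t : ℝ, U t =
      (((Real.sqrt (1 + (p / 2) ^ 2 * t ^ 2))⁻¹ : ℝ) : ℂ) •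
        !![Complex.exp (-(Complex.I / 2) * w), Complex.I / 2 * p * t;
           Complex.I / 2 * p * t, Complex.exp ((Complex.I / 2) * w)])
    (σ₃ : Matrix (Fin 2) (Fin 2) ℂ) (hσ₃ : σ₃ = !![1, 0; 0, -1])
    (X : Matrix (Fin 2) (Fin 2) ℂ)
    (hX : X = (lam : ℂ) • (deriv U lam * (U lam)⁻¹)) :
    (X * σ₃).trace = 0 ∧ ((U lam)⁻¹ * X * U lam * σ₃).trace = 0 := by
  have hpos : 0 < 1 + (p / 2) ^ 2 * lam ^ 2 := by positivity
  have hs : DifferentiableAt ℝ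
      (fun t : ℝ => (((Real.sqrt (1 + (p / 2) ^ 2 * t ^ 2))⁻¹ : ℝ) : ℂ)) lam := by
    have h1 : DifferentiableAt ℝ (fun t : ℝ => (Real.sqrt (1 + (p / 2) ^ 2 * t ^ 2))⁻¹) lam := by
      refine DifferentiableAt.inv (DifferentiableAt.sqrt (by fun_prop) hpos.ne') ?_
      exact (Real.sqrt_pos.mpr hpos).ne'
    exact h1.hasDerivAt.ofReal_comp.differentiableAt
  have hUeq := funext hU
  generalize hsd : (fun t : ℝ => (((Real.sqrt (1 + (p / 2) ^ 2 * t ^ 2))⁻¹ : ℝ) : ℂ)) = s at hs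
  have hU2 : ∀ t, U t = !![s t * Complex.exp (-(Complex.I / 2) * w),
      s t * (Complex.I / 2 * p * t);
      s t * (Complex.I / 2 * p * t), s t * Complex.exp ((Complex.I / 2) * w)] := by
    intro t
    rw [hU t, ← hsd]
    ext i j
    fin_cases i <;> fin_cases j <;> simp
  generalize Complex.exp (-(Complex.I / 2) * w) = a at hU2
  generalize Complex.exp ((Complex.I / 2) * w) = b at hU2
  generalize Complex.I / 2 * (p : ℂ) = c at hU2
  have hd := hs.hasDerivAt
  generalize deriv s lam = s' at hd
  have hl : HasDerivAt (fun t : ℝ => c * (t : ℂ)) c lam := by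
    simpa using (hasDerivAt_id lam).ofReal_comp.const_mul c
  have hD : HasDerivAt U !![s' * a, s' * (c * lam) + s lam * c;
      s' * (c * lam) + s lam * c, s' * b] lam := by
    rw [funext hU2]
    refine hasDerivAt_pi.2 fun i => hasDerivAt_pi.2 fun j => ?_
    fin_cases i <;> fin_cases j
    · exact hd.mul_const a
    · exact hd.mul hl
    · exact hd.mul hl
    · exact hd.mul_const b
  have hE : deriv U lam = !![s' * a, s' * (c * lam) + s lam * c;
      s' * (c * lam) + s lam * c, s' * b] := hD.deriv
  rw [hX, hE, hσ₃, hU2 lam, Matrix.inv_def, Matrix.adjugate_fin_two_of]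
  generalize Ring.inverse (_ : ℂ) = r
  constructor
  · simp [Matrix.trace_fin_two, Matrix.mul_apply, Fin.sum_univ_two]
    ring
  · simp [Matrix.trace_fin_two, Matrix.mul_apply, Fin.sum_univ_two]
    ring
end

section
/- Let u : ℝ² → ℝ be continuously differentiable, fix λ > 0, and let U(x,y) = (i/2)·[[-u_x, λ],[λ, u_x]] and V(x,y) = -(i/2)·[[0, λ^{-1}e^{iu}],[λ^{-1}e^{-iu}, 0]]. Suppose F(x,y,λ) is a GL₂(ℂ)-valued function, smooth in (x,y) and differentiable in λ, satisfying F_x = F·U and F_y = F·V. Then f = λ·(∂F/∂λ)·F^{-1} satisfies f_x = (iλ/2)·F·σ₁·F^{-1} and f_y = (i/(2λ))·F·[[0, e^{iu}],[e^{-iu}, 0]]·F^{-1}, where σ₁ = [[0,1],[1,0]]; in particular -2·trace((f_x)²) = λ² and -2·trace((f_y)²) = λ^{-2}. -/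
open Filter Topology in
theorem symaux_core {R : Type*} [NormedRing R] [NormedAlgebra ℝ R] [CompleteSpace R]
    (l0 : ℝ) (hl0 : 0 < l0) (F U : ℝ → ℝ → R) (B : ℝ → R) (hB : Continuous B)
    (c : ℝ → ℝ) (c' : ℝ) (hc0 : c l0 = 0) (hc : HasDerivAt c c' l0)
    (hU : ∀ lam, 0 < lam → ∀ t, U lam t = U l0 t + c lam • B t)
    (hFlam : ∀ t, DifferentiableAt ℝ (F t) l0)
    (hunit : ∀ t, IsUnit (F t l0))
    (hF : ∀ lam, 0 < lam → ∀ t, HasDerivAt (fun t => F t lam) (F t lam * U lam t) t)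
    (x : ℝ) :
    HasDerivAt (fun t => deriv (F t) l0 * Ring.inverse (F t l0))
      (c' • (F x l0 * B x * Ring.inverse (F x l0))) x := by
  set G : ℝ → R := fun t => Ring.inverse (F t l0) with hG
  have hGF : ∀ t, G t * F t l0 = 1 := fun t => Ring.inverse_mul_cancel _ (hunit t)
  have hFG : ∀ t, F t l0 * G t = 1 := fun t => Ring.mul_inverse_cancel _ (hunit t)
  have hG' : ∀ t, HasDerivAt G (-(U l0 t * G t)) t := by
    intro t
    obtain ⟨w, hw⟩ := hunit t
    have h1 := hasFDerivAt_ringInverse (𝕜 := ℝ) w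
    rw [hw] at h1
    have h2 := h1.comp_hasDerivAt t (hF l0 hl0 t)
    have hwi : (↑w⁻¹ : R) = G t := by
      simp only [hG]; rw [← hw, Ring.inverse_unit]
    refine h2.congr_deriv ?_
    rw [hwi]
    simp only [neg_apply, ContinuousLinearMap.mulLeftRight_apply]
    rw [← mul_assoc (G t), hGF, one_mul]
  set Y : ℝ → R := fun t => F t l0 * B t * G t with hY
  have hYc : Continuous Y := by
    have h1 : Continuous (fun t => F t l0) :=
      continuous_iff_continuousAt.2 fun t => (hF l0 hl0 t).continuousAt
    have h2 : Continuous G := continuous_iff_continuousAt.2 fun t => (hG' t).continuousAt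
    exact (h1.mul hB).mul h2
  set Q : ℝ → ℝ → R := fun lam t => F t lam * G t with hQ
  have hQ' : ∀ lam, 0 < lam → ∀ t, HasDerivAt (Q lam) (c lam • (Q lam t * Y t)) t := by
    intro lam hl t
    refine ((hF lam hl t).mul (hG' t)).congr_deriv ?_
    rw [hU lam hl t]
    have : Q lam t * Y t = F t lam * B t * G t := by
      simp only [hQ, hY]
      calc F t lam * G t * (F t l0 * B t * G t) = F t lam * (G t * F t l0) * B t * G t := by
            noncomm_ring
        _ = _ := by rw [hGF, mul_one]
    rw [this]
    simp only [mul_add, add_mul, mul_neg, mul_smul_comm, smul_mul_assoc, mul_assoc]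
    abel
  obtain ⟨M, hM⟩ := (isCompact_closedBall x 1).exists_bound_of_continuousOn hYc.continuousOn
  have hM0 : 0 ≤ M := (norm_nonneg _).trans (hM x (by simp))
  have hQl : ∀ t, HasDerivAt (fun lam => Q lam t) (deriv (F t) l0 * G t) l0 := fun t =>
    (hFlam t).hasDerivAt.mul_const (G t)
  have hQ0 : ∀ t, Q l0 t = 1 := hFG
  have hctend : Tendsto c (𝓝 l0) (𝓝 0) := by simpa [hc0] using hc.continuousAt.tendsto
  have hQx : Tendsto (fun lam => Q lam x) (𝓝 l0) (𝓝 1) := by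
    simpa [hQ0] using (hQl x).continuousAt.tendsto
  have hsmall : ∀ᶠ lam in 𝓝 l0, |c lam| * M ≤ 1/2 := by
    have : Tendsto (fun lam => |c lam| * M) (𝓝 l0) (𝓝 0) := by
      simpa using hctend.abs.mul_const M
    exact this.eventually (Iic_mem_nhds (by norm_num))
  set δ : ℝ → ℝ := fun lam => ‖Q lam x - 1‖ + |c lam| * M * (2 * ‖Q lam x‖) with hδ
  have hest : ∀ᶠ lam in 𝓝 l0, ∀ t ∈ Metric.closedBall x 1, ‖Q lam t - 1‖ ≤ δ lam := by
    filter_upwards [hsmall, Ioi_mem_nhds hl0] with lam hs hl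
    have hcont : Continuous (Q lam) :=
      continuous_iff_continuousAt.2 fun t => (hQ' lam hl t).continuousAt
    obtain ⟨s, hsm, hmax⟩ := (isCompact_closedBall x 1).exists_isMaxOn
      ⟨x, by simp⟩ hcont.norm.continuousOn
    have hmv : ∀ t ∈ Metric.closedBall x 1, ‖Q lam t - Q lam x‖ ≤ |c lam| * M * ‖Q lam s‖ := by
      intro t ht
      have h := Convex.norm_image_sub_le_of_norm_hasDerivWithin_le (𝕜 := ℝ)
        (f := Q lam) (f' := fun t => c lam • (Q lam t * Y t)) (x := x) (y := t)
        (C := |c lam| * M * ‖Q lam s‖)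
        (fun t _ => (hQ' lam hl t).hasDerivWithinAt) (fun t ht => ?_)
        (convex_closedBall x 1) (Metric.mem_closedBall_self zero_le_one) ht
      · refine h.trans (mul_le_of_le_one_right (by positivity) ?_)
        simpa [dist_eq_norm] using ht
      · rw [norm_smul, Real.norm_eq_abs, mul_assoc |c lam| M]
        refine mul_le_mul_of_nonneg_left ?_ (abs_nonneg _)
        refine (norm_mul_le _ _).trans ?_
        rw [mul_comm M]
        exact mul_le_mul (hmax ht) (hM t ht) (norm_nonneg _) (norm_nonneg _)
    have hS : ‖Q lam s‖ ≤ 2 * ‖Q lam x‖ := by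
      have h1 := hmv s hsm
      have h2 := norm_sub_norm_le (Q lam s) (Q lam x)
      have h3 := mul_le_mul_of_nonneg_right hs (norm_nonneg (Q lam s))
      linarith
    intro t ht
    have h1 := hmv t ht
    have h2 := norm_sub_le_norm_sub_add_norm_sub (Q lam t) (Q lam x) 1
    have h3 : |c lam| * M * ‖Q lam s‖ ≤ |c lam| * M * (2 * ‖Q lam x‖) :=
      mul_le_mul_of_nonneg_left hS (by positivity)
    simp only [hδ]
    linarith
  have hδ0 : Tendsto δ (𝓝 l0) (𝓝 0) := by
    have h1 := (hQx.sub_const 1).norm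
    have h2 := (hctend.abs.mul_const M).mul (hQx.norm.const_mul 2)
    simpa [hδ] using h1.add h2
  have hslope : Tendsto (fun lam => slope c l0 lam) (𝓝[≠] l0) (𝓝 c') :=
    hasDerivAt_iff_tendsto_slope.1 hc
  have hsl : ∀ lam, slope c l0 lam = (lam - l0)⁻¹ * c lam := by
    intro lam; simp [slope, hc0]
  have key := hasDerivAt_of_tendstoUniformlyOn (𝕜 := ℝ) (l := 𝓝[≠] l0)
    (f := fun lam t => (lam - l0)⁻¹ • (Q lam t - 1))
    (f' := fun lam t => slope c l0 lam • (Q lam t * Y t))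
    (g := fun t => deriv (F t) l0 * G t) (g' := fun t => c' • Y t)
    (s := Metric.ball x 1) (x := x) Metric.isOpen_ball ?_ ?_ ?_ (by simp)
  · exact key
  · rw [Metric.tendstoUniformlyOn_iff]
    intro ε hε
    have hb : Tendsto (fun lam => |slope c l0 lam| * (δ lam * M) + |slope c l0 lam - c'| * M)
        (𝓝[≠] l0) (𝓝 0) := by
      have h1 := hslope.abs.mul ((hδ0.mono_left nhdsWithin_le_nhds).mul_const M)
      have h2 := (hslope.sub_const c').abs.mul_const M
      simpa using h1.add h2
    filter_upwards [hb.eventually (Iio_mem_nhds hε), hest.filter_mono nhdsWithin_le_nhds]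
      with lam h1 h2 t ht
    have ht' := Metric.ball_subset_closedBall ht
    refine lt_of_le_of_lt ?_ h1
    rw [dist_comm, dist_eq_norm]
    have : slope c l0 lam • (Q lam t * Y t) - c' • Y t
        = slope c l0 lam • ((Q lam t - 1) * Y t) + (slope c l0 lam - c') • Y t := by
      rw [sub_mul, one_mul, smul_sub, sub_smul]; abel
    rw [this]
    refine (norm_add_le _ _).trans (add_le_add ?_ ?_)
    · rw [norm_smul, Real.norm_eq_abs]
      refine mul_le_mul_of_nonneg_left ((norm_mul_le _ _).trans ?_) (abs_nonneg _)
      exact mul_le_mul (h2 t ht') (hM t ht') (norm_nonneg _) ((norm_nonneg _).trans (h2 t ht'))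
    · rw [norm_smul, Real.norm_eq_abs]
      exact mul_le_mul_of_nonneg_left (hM t ht') (abs_nonneg _)
  · filter_upwards [nhdsWithin_le_nhds (Ioi_mem_nhds hl0)] with lam hl t _
    refine (((hQ' lam hl t).sub_const 1).const_smul ((lam - l0)⁻¹)).congr_deriv ?_
    rw [hsl, mul_smul]
  · intro t _
    have := hasDerivAt_iff_tendsto_slope.1 (hQl t)
    refine this.congr fun lam => ?_
    simp [slope, hQ0]

section
attribute [local instance] Matrix.linftyOpNormedRing Matrix.linftyOpNormedAlgebra
theorem symaux_mat 
    (l0 : ℝ) (hl0 : 0 < l0) (F U : ℝ → ℝ → Matrix (Fin 2) (Fin 2) ℂ)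
    (B : ℝ → Matrix (Fin 2) (Fin 2) ℂ) (hB : Continuous B)
    (c : ℝ → ℝ) (c' : ℝ) (hc0 : c l0 = 0) (hc : HasDerivAt c c' l0)
    (hU : ∀ lam, 0 < lam → ∀ t, U lam t = U l0 t + (c lam : ℂ) • B t)
    (hFlam : ∀ t, DifferentiableAt ℝ (F t) l0)
    (hunit : ∀ t, IsUnit (F t l0))
    (hF : ∀ lam, 0 < lam → ∀ t, HasDerivAt (fun t => F t lam) (F t lam * U lam t) t)
    (x : ℝ) :
    HasDerivAt (fun t => (l0 : ℂ) • (deriv (F t) l0 * (F t l0)⁻¹))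
      ((l0 * c' : ℂ) • (F x l0 * B x * (F x l0)⁻¹)) x := by
  have h := symaux_core l0 hl0 F U B hB c c' hc0 hc hU hFlam hunit hF x
  simp only [← Matrix.nonsing_inv_eq_ringInverse] at h
  refine (h.const_smul l0).congr_deriv ?_
  rw [mul_smul]
  rfl
end


open Matrix

attribute [local instance] Matrix.normedAddCommGroup Matrix.normedSpace

/-- The Sym formula: for an extended frame `F` of a pseudospherical surface
(solution of the Lax pair `F_x = FU`, `F_y = FV`), the map
`f = λ (∂F/∂λ) F⁻¹` satisfies `f_x = (iλ/2) F σ₁ F⁻¹` and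
`f_y = (i/(2λ)) F [[0,e^{iu}],[e^{-iu},0]] F⁻¹`; in particular
`-2 trace(f_x²) = λ²` and `-2 trace(f_y²) = λ⁻²`. -/
theorem sym_formula_derivatives
    (u : ℝ × ℝ → ℝ) (hu : ContDiff ℝ 1 u)
    (lam₀ : ℝ) (hlam₀ : 0 < lam₀)
    (U V : ℝ → ℝ × ℝ → Matrix (Fin 2) (Fin 2) ℂ)
    (hUdef : ∀ lam p, U lam p =
      (Complex.I / 2) •
        !![-(fderiv ℝ u p (1, 0) : ℂ), (lam : ℂ); (lam : ℂ), (fderiv ℝ u p (1, 0) : ℂ)])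
    (hVdef : ∀ lam p, V lam p =
      (-(Complex.I / 2)) •
        !![0, (lam : ℂ)⁻¹ * Complex.exp (Complex.I * u p);
           (lam : ℂ)⁻¹ * Complex.exp (-(Complex.I * u p)), 0])
    (F : ℝ → ℝ → ℝ → Matrix (Fin 2) (Fin 2) ℂ)
    (hFsmooth : ∀ lam : ℝ, 0 < lam → ContDiff ℝ (⊤ : ℕ∞) (fun p : ℝ × ℝ => F p.1 p.2 lam))
    (hFlam : ∀ x y : ℝ, DifferentiableAt ℝ (F x y) lam₀)
    (hFunit : ∀ x y lam : ℝ, 0 < lam → IsUnit (F x y lam))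
    (hFx : ∀ x y : ℝ, ∀ lam : ℝ, 0 < lam →
      HasDerivAt (fun t => F t y lam) (F x y lam * U lam (x, y)) x)
    (hFy : ∀ x y : ℝ, ∀ lam : ℝ, 0 < lam →
      HasDerivAt (fun s => F x s lam) (F x y lam * V lam (x, y)) y)
    (f : ℝ → ℝ → Matrix (Fin 2) (Fin 2) ℂ)
    (hf : ∀ x y : ℝ, f x y = (lam₀ : ℂ) • (deriv (F x y) lam₀ * (F x y lam₀)⁻¹))
    (x y : ℝ) :
    HasDerivAt (fun t => f t y)
      ((Complex.I * lam₀ / 2) • (F x y lam₀ * !![0, 1; 1, 0] * (F x y lam₀)⁻¹)) x ∧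
    HasDerivAt (fun s => f x s)
      ((Complex.I / (2 * lam₀)) •
        (F x y lam₀ *
          !![0, Complex.exp (Complex.I * u (x, y));
             Complex.exp (-(Complex.I * u (x, y))), 0] * (F x y lam₀)⁻¹)) y ∧
    (∀ fx : Matrix (Fin 2) (Fin 2) ℂ,
      fx = (Complex.I * lam₀ / 2) • (F x y lam₀ * !![0, 1; 1, 0] * (F x y lam₀)⁻¹) →
      -2 * (fx * fx).trace = ((lam₀ ^ 2 : ℝ) : ℂ)) ∧
    (∀ fy : Matrix (Fin 2) (Fin 2) ℂ,
      fy = (Complex.I / (2 * lam₀)) •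
        (F x y lam₀ *
          !![0, Complex.exp (Complex.I * u (x, y));
             Complex.exp (-(Complex.I * u (x, y))), 0] * (F x y lam₀)⁻¹) →
      -2 * (fy * fy).trace = (((lam₀ ^ 2 : ℝ)⁻¹ : ℝ) : ℂ)) := by
  have h0 : (lam₀ : ℂ) ≠ 0 := by exact_mod_cast hlam₀.ne'
  have htr : ∀ (a : ℂ) (X W : Matrix (Fin 2) (Fin 2) ℂ), IsUnit X →
      ((a • (X * W * X⁻¹)) * (a • (X * W * X⁻¹))).trace = a ^ 2 * (W * W).trace := by
    intro a X W hX
    have hd := (Matrix.isUnit_iff_isUnit_det X).1 hX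
    have h1 : (X * W * X⁻¹) * (X * W * X⁻¹) = X * (W * W) * X⁻¹ := by
      calc (X * W * X⁻¹) * (X * W * X⁻¹) = X * W * (X⁻¹ * X) * W * X⁻¹ := by
            simp only [Matrix.mul_assoc]
        _ = _ := by rw [Matrix.nonsing_inv_mul X hd]; simp only [Matrix.mul_assoc, Matrix.mul_one]
    rw [Matrix.smul_mul, Matrix.mul_smul, h1, Matrix.trace_smul, Matrix.trace_smul,
      Matrix.trace_mul_comm, ← Matrix.mul_assoc, Matrix.nonsing_inv_mul X hd, Matrix.one_mul,
      smul_eq_mul, smul_eq_mul]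
    ring
  refine ⟨?_, ?_, ?_, ?_⟩
  · have h := symaux_mat lam₀ hlam₀ (fun t lam => F t y lam) (fun lam t => U lam (t, y))
      (fun _ => (Complex.I / 2) • !![0, 1; 1, 0]) continuous_const
      (fun lam => lam - lam₀) 1 (by simp) ((hasDerivAt_id lam₀).sub_const lam₀)
      (fun lam _ t => by
        rw [hUdef, hUdef]
        ext i j
        fin_cases i <;> fin_cases j <;> simp <;> ring)
      (fun t => hFlam t y) (fun t => hFunit t y lam₀ hlam₀)
      (fun lam hl t => hFx t y lam hl) x
    have hfe : (fun t => f t y) = fun t => (lam₀ : ℂ) • (deriv (F t y) lam₀ * (F t y lam₀)⁻¹) :=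
      funext fun t => hf t y
    rw [hfe]
    refine h.congr_deriv ?_
    rw [Matrix.mul_smul, Matrix.smul_mul, smul_smul]
    congr 1
    push_cast
    ring
  · have hcu : Continuous (fun s => u (x, s)) := hu.continuous.comp (by fun_prop)
    have h := symaux_mat lam₀ hlam₀ (fun s lam => F x s lam) (fun lam s => V lam (x, s))
      (fun s => (-(Complex.I / 2)) • !![0, Complex.exp (Complex.I * u (x, s));
             Complex.exp (-(Complex.I * u (x, s))), 0])
      (by
        refine continuous_pi fun i => continuous_pi fun j => ?_
        fin_cases i <;> fin_cases j <;> simp <;> fun_prop)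
      (fun lam => lam⁻¹ - lam₀⁻¹) (-(lam₀ ^ 2)⁻¹) (by simp)
      ((hasDerivAt_inv hlam₀.ne').sub_const _)
      (fun lam _ t => by
        rw [hVdef, hVdef]
        ext i j
        fin_cases i <;> fin_cases j <;> simp <;> ring)
      (fun t => hFlam x t) (fun t => hFunit x t lam₀ hlam₀)
      (fun lam hl t => hFy x t lam hl) y
    have hfe : (fun s => f x s) = fun s => (lam₀ : ℂ) • (deriv (F x s) lam₀ * (F x s lam₀)⁻¹) :=
      funext fun t => hf x t
    rw [hfe]
    refine h.congr_deriv ?_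
    rw [Matrix.mul_smul, Matrix.smul_mul, smul_smul]
    congr 1
    push_cast
    field_simp
  · rintro _ rfl
    rw [htr _ _ _ (hFunit x y lam₀ hlam₀)]
    simp [Matrix.trace_fin_two, div_pow, mul_pow]
    ring
  · rintro _ rfl
    rw [htr _ _ _ (hFunit x y lam₀ hlam₀)]
    simp [Matrix.trace_fin_two, div_pow, mul_pow, ← Complex.exp_add]
    field_simp
    ring
end
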